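/- (Proposition 3.2) For all integers n ≥ 3 and k ≥ 0, the numbers I_{n,k}^B satisfy the linear recurrence n·I_{n,k}^B = (2k+1)·I_{n−1,k}^B + (2n−2k+1)·I_{n−1,k−1}^B + (n−1+2k(k+1))·I_{n−2,k}^B + (2(n−1)+4(n−k−1)(k−1))·I_{n−2,k−1}^B + ((2n−3)(n−1)+2(k−2)(k−2n+1))·I_{n−2,k−2}^B, with the convention I_{n,k}^B = 0 for k < 0. -/

import Mathlib

open scoped Classical

/-- `Ω_n = {±1, …, ±n}` as a subset of `ℤ`. -/
def OmegaSet (n : ℕ) : Set ℤ := {a : ℤ | 1 ≤ |a| ∧ |a| ≤ (n : ℤ)}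

/-- A signed permutation of length `n`: a bijection of `Ω_n` satisfying `w(-a) = -w(a)`,
extended by the identity outside `Ω_n`. -/
def IsSignedPerm (n : ℕ) (w : ℤ → ℤ) : Prop :=
  (∀ a : ℤ, w (-a) = -w a) ∧ Set.BijOn w (OmegaSet n) (OmegaSet n) ∧
    ∀ a : ℤ, a ∉ OmegaSet n → w a = a

/-- An involution in the hyperoctahedral group `B_n`. -/
def IsSignedInvolution (n : ℕ) (w : ℤ → ℤ) : Prop :=
  IsSignedPerm n w ∧ ∀ a : ℤ, w (w a) = a

/-- The total order `-1 <_r -2 <_r ⋯ <_r 0 <_r 1 <_r 2 <_r ⋯` on `ℤ`. -/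
def rlt (a b : ℤ) : Prop :=
  (a < 0 ∧ b < 0 ∧ b < a) ∨ (a < 0 ∧ 0 ≤ b) ∨ (0 ≤ a ∧ 0 ≤ b ∧ a < b)

/-- `des_B(w) = #{ i ∈ {0,…,n-1} : w(i) >_r w(i+1) }` (with `w(0) = 0`, which is forced by
antisymmetry). -/
noncomputable def desB (n : ℕ) (w : ℤ → ℤ) : ℕ :=
  ((Finset.range n).filter fun i : ℕ => rlt (w ((i : ℤ) + 1)) (w (i : ℤ))).card

/-- `I_{n,k}^B`, the number of involutions `w` in `B_n` with `des_B(w) = k`. -/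
noncomputable def InkB (n k : ℕ) : ℕ :=
  {w : ℤ → ℤ | IsSignedInvolution n w ∧ desB n w = k}.ncard

/-- `I_{n,k}^B` extended by `0` for negative `k`, as an integer. -/
noncomputable def IZ (n : ℕ) (k : ℤ) : ℤ :=
  if 0 ≤ k then (InkB n k.toNat : ℤ) else 0

/-- The functions `c : T → ℕ` of total `n` that are invariant under `τ`. -/
noncomputable def symFun {T : Type*} [Fintype T] (τ : T → T) (n : ℕ) : Finset (T → ℕ) :=
  (Finset.univ.piAntidiag n).filter fun c => ∀ t, c (τ t) = c t

theorem mem_symFun {T : Type*} [Fintype T] {τ : T → T} {n : ℕ} {c : T → ℕ} :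
    c ∈ symFun τ n ↔ ∑ t, c t = n ∧ ∀ t, c (τ t) = c t := by
  simp [symFun]

theorem sum_symFun_add {T : Type*} [Fintype T] {τ : T → T} (n : ℕ) {r : ℕ} {t : T} {d : T → ℕ}
    (hd : d ∈ symFun τ r) (hdt : d t = 1)
    (hle : ∀ c : T → ℕ, (∀ x, c (τ x) = c x) → c t ≠ 0 → d ≤ c) :
    ∑ c ∈ symFun τ (n + r), c t = (symFun τ n).card + ∑ c ∈ symFun τ n, c t := by
  rw [Finset.card_eq_sum_ones, ← Finset.sum_add_distrib]
  rw [mem_symFun] at hd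
  symm
  apply Finset.sum_of_injOn (fun c => c + d)
  · intro a _ b _ h
    simpa using h
  · intro c hc
    simp only [Finset.mem_coe, mem_symFun] at hc ⊢
    simp [Finset.sum_add_distrib, hc.1, hd.1, hc.2, hd.2]
  · intro c hc hcn
    by_contra h0
    rw [mem_symFun] at hc
    have hdc := hle c hc.2 h0
    refine hcn ⟨c - d, ?_, tsub_add_cancel_of_le hdc⟩
    simp only [Finset.mem_coe, mem_symFun, Pi.sub_apply]
    refine ⟨?_, fun x => by rw [hc.2, hd.2]⟩
    rw [Finset.sum_tsub_distrib _ fun x _ => hdc x, hc.1, hd.1]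
    omega
  · intro c _
    simp [hdt, add_comm]

theorem sum_symFun_fixed {T : Type*} [Fintype T] {τ : T → T} (hτ : Function.Involutive τ) (n : ℕ)
    {t : T} (ht : τ t = t) :
    ∑ c ∈ symFun τ (n + 1), c t = (symFun τ n).card + ∑ c ∈ symFun τ n, c t := by
  apply sum_symFun_add n (d := Pi.single t 1)
  · rw [mem_symFun]
    refine ⟨by simp, fun x => ?_⟩
    have : τ x = t ↔ x = t := ⟨fun h => by rw [← hτ x, h, ht], fun h => by rw [h, ht]⟩
    simp only [Pi.single_apply, this]
  · simp
  · intro c _ h x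
    rw [Pi.single_apply]
    split_ifs with hx
    · subst hx
      exact Nat.one_le_iff_ne_zero.2 h
    · exact Nat.zero_le _

theorem sum_symFun_of_ne {T : Type*} [Fintype T] {τ : T → T} (hτ : Function.Involutive τ) (n : ℕ)
    {t : T} (ht : τ t ≠ t) :
    ∑ c ∈ symFun τ (n + 2), c t = (symFun τ n).card + ∑ c ∈ symFun τ n, c t := by
  apply sum_symFun_add n (d := Pi.single t 1 + Pi.single (τ t) 1)
  · rw [mem_symFun]
    refine ⟨by simp [Finset.sum_add_distrib], fun x => ?_⟩
    have h1 : τ x = t ↔ x = τ t := ⟨fun h => by rw [← hτ x, h], fun h => by rw [h, hτ]⟩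
    have h2 : τ x = τ t ↔ x = t := hτ.injective.eq_iff
    simp only [Pi.add_apply, Pi.single_apply, h1, h2, add_comm]
  · simp [ht.symm]
  · intro c hc h x
    have := hc t
    simp only [Pi.add_apply, Pi.single_apply]
    split_ifs with h1 h2 h2
    · exact absurd (h2.symm.trans h1) ht
    · subst h1
      exact Nat.one_le_iff_ne_zero.2 h
    · subst h2
      exact Nat.one_le_iff_ne_zero.2 (this.symm ▸ h)
    · exact Nat.zero_le _

theorem card_symFun_recurrence {T : Type*} [Fintype T] {τ : T → T} (hτ : Function.Involutive τ)
    (n : ℕ) :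
    (n + 2) * (symFun τ (n + 2)).card =
      (Finset.univ.filter fun t => τ t = t).card * (symFun τ (n + 1)).card +
        (Fintype.card T + n) * (symFun τ n).card := by
  have total (N : ℕ) : ∑ t, ∑ c ∈ symFun τ N, c t = N * (symFun τ N).card := by
    rw [Finset.sum_comm, Finset.sum_congr rfl fun c hc => (mem_symFun.1 hc).1]
    simp [mul_comm]
  have step (t : T) : ∑ c ∈ symFun τ (n + 2), c t =
      (if τ t = t then (symFun τ (n + 1)).card else 0) + (symFun τ n).card +
        ∑ c ∈ symFun τ n, c t := by
    split_ifs with h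
    · rw [sum_symFun_fixed hτ (n + 1) h, sum_symFun_fixed hτ n h, add_assoc]
    · rw [sum_symFun_of_ne hτ n h, zero_add]
  rw [← total, Finset.sum_congr rfl fun t _ => step t, Finset.sum_add_distrib,
    Finset.sum_add_distrib, total, ← Finset.sum_filter, Finset.sum_const, Finset.sum_const,
    Finset.card_univ]
  simp only [smul_eq_mul]
  ring

/-- Pairs of a weakly increasing word `L` and an involution `σ` that intertwines `L` with `τ ∘ L`
and increases along each level set of `L`. -/
noncomputable def standardPairs {T : Type*} [Fintype T] [LinearOrder T] (τ : T → T) (n : ℕ) :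
    Finset ((Fin n → T) × (Fin n → Fin n)) :=
  Finset.univ.filter fun p => Monotone p.1 ∧ Function.Involutive p.2 ∧
    (∀ i, p.1 (p.2 i) = τ (p.1 i)) ∧ ∀ i j, i < j → p.1 i = p.1 j → p.2 i < p.2 j

theorem mem_standardPairs {T : Type*} [Fintype T] [LinearOrder T] {τ : T → T} {n : ℕ}
    {p : (Fin n → T) × (Fin n → Fin n)} :
    p ∈ standardPairs τ n ↔ Monotone p.1 ∧ Function.Involutive p.2 ∧
      (∀ i, p.1 (p.2 i) = τ (p.1 i)) ∧ ∀ i j, i < j → p.1 i = p.1 j → p.2 i < p.2 j := by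
  simp [standardPairs]

theorem monotone_eq_of_card_fiber_eq {T : Type*} [LinearOrder T] {n : ℕ} {L L' : Fin n → T}
    (hL : Monotone L) (hL' : Monotone L')
    (h : ∀ t, (Finset.univ.filter fun i => L i = t).card =
      (Finset.univ.filter fun i => L' i = t).card) : L = L' := by
  apply List.ofFn_injective
  refine List.Perm.eq_of_sortedLE hL.sortedLE_ofFn hL'.sortedLE_ofFn ?_
  rw [List.perm_iff_count]
  intro t
  have key (M : Fin n → T) :
      (List.ofFn M).count t = (Finset.univ.filter fun i => M i = t).card := by
    rw [List.count_eq_countP, List.ofFn_eq_map, List.countP_map, Finset.card_def,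
      Finset.filter_val, ← Multiset.countP_eq_card_filter]
    change _ = Multiset.countP _ (↑(List.finRange n) : Multiset (Fin n))
    rw [Multiset.coe_countP]
    congr 1
  rw [key, key, h]

theorem intertwiner_unique {T : Type*} [LinearOrder T] {n : ℕ} {τ : T → T}
    (hτ : Function.Involutive τ) {L : Fin n → T} (hL : Monotone L) {σ σ' : Fin n → Fin n}
    (hσ : ∀ i, L (σ i) = τ (L i)) (hσ' : ∀ i, L (σ' i) = τ (L i))
    (hinv : Function.Involutive σ')
    (hs : ∀ i j, i < j → L i = L j → σ i < σ j)
    (hs' : ∀ i j, i < j → L i = L j → σ' i < σ' j) : σ = σ' := by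
  have hmono : StrictMono (σ' ∘ σ) := by
    intro i j hij
    rcases (hL hij.le).lt_or_eq with h | h
    · by_contra hn
      have := hL (not_lt.1 hn)
      simp only [Function.comp, hσ, hσ', hτ _] at this
      exact absurd this (not_le.2 h)
    · exact hs' _ _ (hs _ _ hij h) (by rw [hσ, hσ, h])
  have hid : σ' ∘ σ = id := le_antisymm hmono.le_id hmono.id_le
  funext i
  rw [← hinv (σ i)]
  exact congrArg σ' (congrFun hid i)

theorem exists_standardPair {T : Type*} [Fintype T] [LinearOrder T] {τ : T → T}
    (hτ : Function.Involutive τ) {n : ℕ} {c : T → ℕ} (hc : c ∈ symFun τ n) :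
    ∃ p ∈ standardPairs τ n, (fun t => (Finset.univ.filter fun i => p.1 i = t).card) = c := by
  rw [mem_symFun] at hc
  let P := {p : T ×ₗ ℕ // (ofLex p).2 < c (ofLex p).1}
  let eP : P ≃ Σ t : T, Fin (c t) :=
    { toFun p := ⟨(ofLex p.1).1, (ofLex p.1).2, p.2⟩
      invFun q := ⟨toLex (q.1, q.2), q.2.2⟩
      left_inv _ := rfl
      right_inv _ := rfl }
  let _ : Fintype P := Fintype.ofEquiv _ eP.symm
  have hcard : Fintype.card P = n := by
    rw [Fintype.card_congr eP, Fintype.card_sigma, ← hc.1]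
    simp
  let e : Fin n ≃o P := monoEquivOfFin P hcard
  let sw : P → P := fun p => ⟨toLex (τ (ofLex p.1).1, (ofLex p.1).2), by simpa [hc.2] using p.2⟩
  have sw_sw (p : P) : sw (sw p) = p := by
    apply Subtype.ext
    simp [sw, hτ _]
  refine ⟨(fun i => (ofLex (e i).1).1, fun i => e.symm (sw (e i))), ?_, ?_⟩
  · rw [mem_standardPairs]
    refine ⟨fun i j hij => ?_, fun i => ?_, fun i => ?_, fun i j hij h => ?_⟩
    · exact Prod.Lex.monotone_fst_ofLex (e.monotone hij)
    · simp [sw_sw]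
    · simp only [OrderIso.apply_symm_apply]
      rfl
    · have := e.strictMono hij
      rw [← Subtype.coe_lt_coe, Prod.Lex.lt_iff] at this
      change e.symm _ < e.symm _
      rw [e.symm.lt_iff_lt, ← Subtype.coe_lt_coe, Prod.Lex.lt_iff]
      exact Or.inr ⟨congrArg τ h, (this.resolve_left (h.not_lt)).2⟩
  · funext t
    refine (Finset.card_nbij (t := Finset.range (c t)) (fun i => (ofLex (e i).1).2)
      ?_ ?_ ?_).trans (Finset.card_range _)
    · intro i hi
      have hi : (ofLex (e i).1).1 = t := by simpa using hi
      simpa [hi] using (e i).2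
    · intro i hi j hj h
      have hi : (ofLex (e i).1).1 = t := by simpa using hi
      have hj : (ofLex (e j).1).1 = t := by simpa using hj
      exact e.injective (Subtype.ext (ofLex.injective (Prod.ext (hi.trans hj.symm) h)))
    · intro k hk
      have hk : k < c t := by simpa using hk
      exact ⟨e.symm ⟨toLex (t, k), hk⟩, by simp, by simp⟩

theorem card_standardPairs {T : Type*} [Fintype T] [LinearOrder T] {τ : T → T}
    (hτ : Function.Involutive τ) (n : ℕ) :
    (standardPairs τ n).card = (symFun τ n).card := by
  refine Finset.card_nbij (fun p t => (Finset.univ.filter fun i => p.1 i = t).card) ?_ ?_ ?_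
  · intro p hp
    rw [Finset.mem_coe, mem_standardPairs] at hp
    obtain ⟨-, hinv, hL, -⟩ := hp
    rw [Finset.mem_coe, mem_symFun]
    constructor
    · rw [← Finset.card_eq_sum_card_fiberwise fun i _ => Finset.mem_coe.2 (Finset.mem_univ (p.1 i))]
      simp
    · intro t
      refine Finset.card_nbij' p.2 p.2 ?_ ?_ (fun i _ => hinv i) (fun i _ => hinv i)
      · intro i hi
        simp_all [hτ _]
      · intro i hi
        simp_all
  · intro p hp q hq h
    rw [Finset.mem_coe, mem_standardPairs] at hp hq
    obtain ⟨L, σ⟩ := p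
    obtain ⟨L', σ'⟩ := q
    obtain rfl : L = L' := monotone_eq_of_card_fiber_eq hp.1 hq.1 fun t => congrFun h t
    exact Prod.ext rfl (intertwiner_unique hτ hp.1 hp.2.2.1 hq.2.2.1 hq.2.1 hp.2.2.2 hq.2.2.2)
  · intro c hc
    obtain ⟨p, hp, h⟩ := exists_standardPair hτ hc
    exact ⟨p, hp, h⟩

/-- The letters `(a, s, b)` with `a, b ≤ m`, where the sign `s = false` (that is, `-`) is only
allowed when `a` and `b` are both nonzero, ordered lexicographically. -/
abbrev Letter (m : ℕ) : Type :=
  {x : Fin (m + 1) ×ₗ Bool ×ₗ Fin (m + 1) //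
    (ofLex (ofLex x).2).1 = false → (ofLex x).1 ≠ 0 ∧ (ofLex (ofLex x).2).2 ≠ 0}

namespace Letter

variable {m : ℕ}

/-- The first entry of a letter. -/
def fst (x : Letter m) : Fin (m + 1) := (ofLex x.1).1

/-- The sign of a letter. -/
def sgn (x : Letter m) : Bool := (ofLex (ofLex x.1).2).1

/-- The last entry of a letter. -/
def snd (x : Letter m) : Fin (m + 1) := (ofLex (ofLex x.1).2).2

/-- The letter with given entries. -/
def mk (a : Fin (m + 1)) (s : Bool) (b : Fin (m + 1)) (h : s = false → a ≠ 0 ∧ b ≠ 0) : Letter m :=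
  ⟨toLex (a, toLex (s, b)), h⟩

theorem ext {x y : Letter m} (h₁ : x.fst = y.fst) (h₂ : x.sgn = y.sgn) (h₃ : x.snd = y.snd) :
    x = y :=
  Subtype.ext (ofLex.injective (Prod.ext h₁ (ofLex.injective (Prod.ext h₂ h₃))))

theorem ne_zero (x : Letter m) (h : x.sgn = false) : x.fst ≠ 0 ∧ x.snd ≠ 0 := x.2 h

/-- Exchange the two entries of a letter. -/
def swap (x : Letter m) : Letter m :=
  mk x.snd x.sgn x.fst fun h => (x.ne_zero h).symm

@[simp] theorem fst_mk (a : Fin (m + 1)) (s b h) : (mk a s b h).fst = a := rfl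
@[simp] theorem sgn_mk (a : Fin (m + 1)) (s b h) : (mk a s b h).sgn = s := rfl
@[simp] theorem snd_mk (a : Fin (m + 1)) (s b h) : (mk a s b h).snd = b := rfl
@[simp] theorem fst_swap (x : Letter m) : x.swap.fst = x.snd := rfl
@[simp] theorem sgn_swap (x : Letter m) : x.swap.sgn = x.sgn := rfl
@[simp] theorem snd_swap (x : Letter m) : x.swap.snd = x.fst := rfl

theorem swap_involutive : Function.Involutive (swap (m := m)) := fun _ => rfl

theorem lt_iff {x y : Letter m} : x < y ↔ x.fst < y.fst ∨
    x.fst = y.fst ∧ (x.sgn < y.sgn ∨ x.sgn = y.sgn ∧ x.snd < y.snd) := by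
  rw [← Subtype.coe_lt_coe, Prod.Lex.lt_iff, Prod.Lex.lt_iff]
  rfl

theorem card_eq (m : ℕ) : Fintype.card (Letter m) = 2 * m * (m + 1) + 1 := by
  let g : (Fin (m + 1) × Fin (m + 1)) ⊕ (Fin m × Fin m) → Letter m :=
    Sum.elim (fun p => mk p.1 true p.2 (by simp))
      (fun p => mk p.1.succ false p.2.succ (by simp))
  have hg : Function.Bijective g := by
    constructor
    · rintro (p | p) (q | q) h <;>
        have h₁ := congrArg fst h <;> have h₂ := congrArg sgn h <;> have h₃ := congrArg snd h <;>
        simp [g] at h₁ h₂ h₃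
      · exact congrArg _ (Prod.ext h₁ h₃)
      · exact congrArg _ (Prod.ext h₁ h₃)
    · intro x
      cases h : x.sgn with
      | true => exact ⟨Sum.inl (x.fst, x.snd), ext rfl h.symm rfl⟩
      | false =>
        obtain ⟨h₁, h₂⟩ := x.ne_zero h
        exact ⟨Sum.inr (x.fst.pred h₁, x.snd.pred h₂),
          ext (Fin.succ_pred _ h₁) h.symm (Fin.succ_pred _ h₂)⟩
  rw [← Fintype.card_of_bijective hg]
  simp
  ring

theorem card_fixed (m : ℕ) :
    (Finset.univ.filter fun x : Letter m => x.swap = x).card = 2 * m + 1 := by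
  let g : Fin (m + 1) ⊕ Fin m → Letter m :=
    Sum.elim (fun a => mk a true a (by simp)) (fun a => mk a.succ false a.succ (by simp))
  have hg : Function.Injective g := by
    rintro (p | p) (q | q) h <;>
      have h₁ := congrArg fst h <;> have h₂ := congrArg sgn h <;>
      simp [g] at h₁ h₂
    · exact congrArg _ h₁
    · exact congrArg _ h₁
  have himg : (Finset.univ.filter fun x : Letter m => x.swap = x) = Finset.univ.image g := by
    ext x
    simp only [Finset.mem_filter, Finset.mem_univ, true_and, Finset.mem_image]
    constructor
    · intro hx
      have hx : x.snd = x.fst := congrArg fst hx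
      cases h : x.sgn with
      | true => exact ⟨Sum.inl x.fst, ext rfl h.symm hx.symm⟩
      | false =>
        have h₁ := (x.ne_zero h).1
        exact ⟨Sum.inr (x.fst.pred h₁),
          ext (Fin.succ_pred _ h₁) h.symm ((Fin.succ_pred _ h₁).trans hx.symm)⟩
    · rintro ⟨(a | a), rfl⟩ <;> rfl
  rw [himg, Finset.card_image_of_injective _ hg]
  simp
  ring

end Letter

/-- The pairs `(σ, s)` of an involution of `Fin n` and a `σ`-invariant choice of signs; they encode
the signed involutions. -/
noncomputable def signedPairs (n : ℕ) : Finset ((Fin n → Fin n) × (Fin n → Bool)) :=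
  Finset.univ.filter fun x => Function.Involutive x.1 ∧ ∀ i, x.2 (x.1 i) = x.2 i

theorem mem_signedPairs {n : ℕ} {x : (Fin n → Fin n) × (Fin n → Bool)} :
    x ∈ signedPairs n ↔ Function.Involutive x.1 ∧ ∀ i, x.2 (x.1 i) = x.2 i := by
  simp [signedPairs]

/-- `f` is weakly increasing and nonnegative with strict increase at the descents of the signed
permutation encoded by `x`. -/
def IsCompatible {n m : ℕ} (x : (Fin n → Fin n) × (Fin n → Bool)) (f : Fin n → Fin (m + 1)) :
    Prop :=
  StrictMono (fun i => toLex (f i, toLex (x.2 i, x.1 i))) ∧ ∀ i, f i = 0 → x.2 i = true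

theorem sum_card_compatible (n m : ℕ) :
    ∑ x ∈ signedPairs n, (Finset.univ.filter fun f : Fin n → Fin (m + 1) => IsCompatible x f).card =
      (standardPairs (Letter.swap (m := m)) n).card := by
  rw [← Finset.card_sigma]
  symm
  refine Finset.card_nbij (fun p => ⟨(p.2, fun i => (p.1 i).sgn), fun i => (p.1 i).fst⟩) ?_ ?_ ?_
  · rintro ⟨L, σ⟩ hp
    simp only [Finset.mem_coe, mem_standardPairs] at hp
    obtain ⟨hmono, hinv, hL, hs⟩ := hp
    simp only [Finset.mem_coe, Finset.mem_sigma, mem_signedPairs, Finset.mem_filter,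
      Finset.mem_univ, true_and]
    have hsnd (i) : (L i).snd = (L (σ i)).fst := by rw [hL]; rfl
    refine ⟨⟨hinv, fun i => by rw [hL]; rfl⟩, fun i j hij => ?_, fun i hi => ?_⟩
    · simp only [Prod.Lex.toLex_lt_toLex]
      rcases (hmono hij.le).lt_or_eq with h | h
      · rw [Letter.lt_iff] at h
        refine h.imp_right (And.imp_right (Or.imp_right (And.imp_right fun h' => ?_)))
        rw [hsnd, hsnd] at h'
        by_contra hn
        exact (hmono (not_lt.1 hn)).not_gt (Letter.lt_iff.2 (Or.inl h'))
      · exact Or.inr ⟨by rw [h], Or.inr ⟨by rw [h], hs _ _ hij h⟩⟩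
    · by_contra h
      exact ((L i).ne_zero (by simpa using h)).1 hi
  · rintro ⟨L, σ⟩ hp ⟨L', σ'⟩ hq h
    simp only [Finset.mem_coe, mem_standardPairs] at hp hq
    simp only [Sigma.mk.injEq, Prod.mk.injEq, heq_eq_eq] at h
    obtain ⟨⟨rfl, h₂⟩, h₁⟩ := h
    refine Prod.ext (funext fun i => Letter.ext (congrFun h₁ i) (congrFun h₂ i) ?_) rfl
    have e₁ := congrArg Letter.fst (hp.2.2.1 i)
    have e₂ := congrArg Letter.fst (hq.2.2.1 i)
    exact e₁.symm.trans ((congrFun h₁ _).trans e₂)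
  · rintro ⟨⟨σ, s⟩, f⟩ hx
    simp only [Finset.mem_coe, Finset.mem_sigma, mem_signedPairs, Finset.mem_filter,
      Finset.mem_univ, true_and] at hx
    obtain ⟨⟨hinv, hsσ⟩, hmono, hpos⟩ := hx
    have hne (i) (h : s i = false) : f i ≠ 0 := fun h0 =>
      Bool.false_ne_true (h.symm.trans (hpos i h0))
    have hlt {i j : Fin n} (hij : i < j) : f i < f j ∨
        f i = f j ∧ (s i < s j ∨ s i = s j ∧ σ i < σ j) := by
      exact (Prod.Lex.toLex_lt_toLex.1 (hmono hij)).imp_right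
        (And.imp_right Prod.Lex.toLex_lt_toLex.1)
    have hf : Monotone f := fun i j hij => by
      rcases hij.lt_or_eq with h | rfl
      · exact (hlt h).elim le_of_lt fun h => h.1.le
      · exact le_rfl
    refine ⟨(fun i => Letter.mk (f i) (s i) (f (σ i))
      fun h => ⟨hne i h, hne _ ((hsσ i).trans h)⟩, σ), ?_, rfl⟩
    rw [Finset.mem_coe, mem_standardPairs]
    refine ⟨fun i j hij => ?_, hinv, fun i => ?_, fun i j hij h => ?_⟩
    · rcases hij.lt_or_eq with h | rfl
      · rcases hlt h with h | ⟨h₁, h | ⟨h₂, h⟩⟩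
        · exact le_of_lt (Letter.lt_iff.2 (Or.inl h))
        · exact le_of_lt (Letter.lt_iff.2 (Or.inr ⟨h₁, Or.inl h⟩))
        · rcases (hf h.le).lt_or_eq with h₃ | h₃
          · exact le_of_lt (Letter.lt_iff.2 (Or.inr ⟨h₁, Or.inr ⟨h₂, h₃⟩⟩))
          · exact le_of_eq (Letter.ext h₁ h₂ h₃)
      · exact le_rfl
    · exact Letter.ext rfl (hsσ i) (congrArg f (hinv i))
    · have h₁ : f i = f j := congrArg Letter.fst h
      have h₂ : s i = s j := congrArg Letter.sgn h
      simpa [h₁, h₂] using hlt hij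

/-- The functions on `{0, …, n}` that start at `0`, end at most at `M`, and increase by at least
`a i` in the `i`-th step. -/
@[ext]
structure GapFun {n : ℕ} (a : Fin n → ℕ) (M : ℕ) where
  /-- The underlying function. -/
  val : Fin (n + 1) → ℕ
  val_zero : val 0 = 0
  val_last : val (Fin.last n) ≤ M
  gap : ∀ i : Fin n, val i.castSucc + a i ≤ val i.succ

theorem partialSum_last {n : ℕ} (b : Fin n → ℕ) : Fin.partialSum b (Fin.last n) = ∑ i, b i := by
  rw [Fin.partialSum, Fin.val_last, List.take_of_length_le (by simp), List.sum_ofFn]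

theorem GapFun.partialSum_le {n M : ℕ} {a b : Fin n → ℕ} (H : GapFun (fun i => a i + b i) M)
    (i : Fin (n + 1)) : Fin.partialSum b i ≤ H.val i := by
  induction i using Fin.induction with
  | zero => simp
  | succ k ih =>
    have := H.gap k
    rw [Fin.partialSum_succ]
    omega

/-- Adding the partial sums of `b` increases the gaps by `b`. -/
def GapFun.shift {n : ℕ} (a b : Fin n → ℕ) (M : ℕ) :
    GapFun a M ≃ GapFun (fun i => a i + b i) (M + ∑ i, b i) where
  toFun F :=
    { val i := F.val i + Fin.partialSum b i
      val_zero := by simp [F.val_zero]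
      val_last := by
        rw [partialSum_last]
        exact Nat.add_le_add_right F.val_last _
      gap i := by
        have := F.gap i
        rw [Fin.partialSum_succ]
        omega }
  invFun H :=
    { val i := H.val i - Fin.partialSum b i
      val_zero := by simp [H.val_zero]
      val_last := by
        rw [partialSum_last]
        exact Nat.sub_le_of_le_add H.val_last
      gap i := by
        have h₁ := H.gap i
        have h₂ := H.partialSum_le i.castSucc
        rw [Fin.partialSum_succ]
        omega }
  left_inv F := GapFun.ext (funext fun i => Nat.add_sub_cancel ..)
  right_inv H := GapFun.ext (funext fun i => Nat.sub_add_cancel (H.partialSum_le i))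

theorem GapFun.strictMono {n M : ℕ} (F : GapFun (fun _ : Fin n => 1) M) : StrictMono F.val :=
  Fin.strictMono_iff_lt_succ.2 F.gap

theorem GapFun.succ_pos {n M : ℕ} (F : GapFun (fun _ : Fin n => 1) M) (i : Fin n) :
    0 < F.val i.succ :=
  F.val_zero ▸ F.strictMono (Fin.succ_pos i)

/-- Functions with all gaps positive are the strictly increasing sequences. -/
def GapFun.equivOrderEmbedding (n M : ℕ) :
    GapFun (fun _ : Fin n => 1) M ≃ (Fin n ↪o Fin M) where
  toFun F := OrderEmbedding.ofStrictMono
    (fun i => ⟨F.val i.succ - 1, by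
      have h₁ := F.succ_pos i
      have h₂ := F.strictMono.monotone (Fin.le_last i.succ)
      have h₃ := F.val_last
      omega⟩)
    (fun i j hij => by
      have h₁ := F.succ_pos i
      have h₂ := F.strictMono (Fin.succ_lt_succ_iff.2 hij)
      rw [Fin.lt_def]
      dsimp only
      omega)
  invFun g :=
    { val := Fin.cons 0 fun i => (g i : ℕ) + 1
      val_zero := rfl
      val_last := by
        cases n with
        | zero => exact Nat.zero_le _
        | succ k =>
          rw [← Fin.succ_last, Fin.cons_succ]
          exact (g _).2
      gap i := by
        rw [Fin.cons_succ]
        cases n with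
        | zero => exact i.elim0
        | succ k =>
          cases i using Fin.cases with
          | zero => simp
          | succ j =>
            rw [← Fin.succ_castSucc, Fin.cons_succ]
            exact Nat.succ_le_succ (g.strictMono Fin.castSucc_lt_succ) }
  left_inv F := GapFun.ext (funext fun i => by
    cases i using Fin.cases with
    | zero => exact F.val_zero.symm
    | succ j => exact Nat.sub_add_cancel (F.succ_pos j))
  right_inv g := rfl

theorem GapFun.card {n : ℕ} (a : Fin n → ℕ) (ha : ∀ i, a i ≤ 1) (m : ℕ) :
    Nat.card (GapFun a m) = (m + (n - ∑ i, a i)).choose n := by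
  have hsum : ∑ i, (1 - a i) = n - ∑ i, a i := by
    rw [Finset.sum_tsub_distrib _ fun i _ => ha i]
    simp
  have hone : (fun i => a i + (1 - a i)) = fun _ => 1 :=
    funext fun i => Nat.add_sub_cancel' (ha i)
  rw [Nat.card_congr (GapFun.shift a (fun i => 1 - a i) m), hsum, hone,
    Nat.card_congr (GapFun.equivOrderEmbedding n _),
    Nat.card_congr Set.powersetCard.ofFinEmbEquiv, Set.powersetCard.card, Nat.card_fin]

/-- The sequence of values, starting at position `0`, of the signed permutation encoded by `x`,
written in a way that turns the order `<_r` into the lexicographic order. -/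
def keyFun {n : ℕ} (x : (Fin n → Fin n) × (Fin n → Bool)) : Fin (n + 1) → Bool ×ₗ ℕ :=
  Fin.cons (toLex (true, 0)) fun i => toLex (x.2 i, (x.1 i : ℕ) + 1)

/-- The indicator function of the descents of the signed permutation encoded by `x`. -/
noncomputable def descFun {n : ℕ} (x : (Fin n → Fin n) × (Fin n → Bool)) (i : Fin n) : ℕ :=
  if keyFun x i.succ < keyFun x i.castSucc then 1 else 0

theorem keyFun_injective {n : ℕ} {x : (Fin n → Fin n) × (Fin n → Bool)}
    (hx : Function.Injective x.1) : Function.Injective (keyFun x) := by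
  refine Fin.cons_injective_iff.2 ⟨?_, fun i j h => hx (Fin.ext ?_)⟩
  · rintro ⟨i, hi⟩
    exact absurd (congrArg (fun p => (ofLex p).2) hi) (Nat.succ_ne_zero _)
  · exact Nat.succ_injective (congrArg (fun p => (ofLex p).2) h)

theorem isCompatible_iff_strictMono {n m : ℕ} {x : (Fin n → Fin n) × (Fin n → Bool)}
    {f : Fin n → Fin (m + 1)} : IsCompatible x f ↔ StrictMono fun i : Fin (n + 1) =>
      toLex ((Fin.cons 0 fun i => (f i : ℕ) : Fin (n + 1) → ℕ) i, keyFun x i) := by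
  constructor
  · rintro ⟨hmono, hpos⟩ i j hij
    cases j using Fin.cases with
    | zero => exact absurd hij (Fin.not_lt_zero _)
    | succ j =>
      simp only [Prod.Lex.toLex_lt_toLex, keyFun, Fin.cons_succ]
      cases i using Fin.cases with
      | zero =>
        simp only [Fin.cons_zero, Prod.Lex.toLex_lt_toLex]
        rcases Nat.eq_zero_or_pos (f j : ℕ) with h | h
        · exact Or.inr ⟨h.symm, Or.inr ⟨(hpos j (Fin.ext h)).symm, Nat.succ_pos _⟩⟩
        · exact Or.inl h
      | succ i =>
        simp only [Fin.cons_succ, Prod.Lex.toLex_lt_toLex, Nat.add_lt_add_iff_right]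
        refine (Prod.Lex.toLex_lt_toLex.1 (hmono (Fin.succ_lt_succ_iff.1 hij))).imp_right fun h =>
          ⟨congrArg Fin.val h.1, Prod.Lex.toLex_lt_toLex.1 h.2⟩
  · intro h
    constructor
    · intro i j hij
      have := h (Fin.succ_lt_succ_iff.2 hij)
      simp only [Prod.Lex.toLex_lt_toLex, keyFun, Fin.cons_succ, Nat.add_lt_add_iff_right] at this
      refine Prod.Lex.toLex_lt_toLex.2 (this.imp_right fun h =>
          ⟨Fin.ext h.1, Prod.Lex.toLex_lt_toLex.2 h.2⟩)
    · intro i hi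
      have := h (Fin.succ_pos i)
      simp only [Prod.Lex.toLex_lt_toLex, keyFun, Fin.cons_succ, Fin.cons_zero, hi] at this
      cases hs : x.2 i <;> simp [hs] at this ⊢
      exact absurd this (by decide)

theorem isCompatible_iff_gap {n m : ℕ} {x : (Fin n → Fin n) × (Fin n → Bool)}
    (hx : Function.Injective x.1) {f : Fin n → Fin (m + 1)} : IsCompatible x f ↔ ∀ i : Fin n,
      (Fin.cons 0 fun i => (f i : ℕ) : Fin (n + 1) → ℕ) i.castSucc + descFun x i ≤
        (Fin.cons 0 fun i => (f i : ℕ) : Fin (n + 1) → ℕ) i.succ := by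
  rw [isCompatible_iff_strictMono, Fin.strictMono_iff_lt_succ]
  refine forall_congr' fun i => ?_
  rw [Prod.Lex.toLex_lt_toLex, descFun]
  have hne := (keyFun_injective hx).ne (Fin.castSucc_lt_succ (i := i)).ne
  rcases hne.lt_or_gt with h | h
  · simp only [h, h.not_gt, and_true, if_false]
    exact le_iff_lt_or_eq.symm
  · simp only [h, h.not_gt, and_false, or_false, if_true]
    exact Nat.lt_iff_add_one_le

theorem card_isCompatible {n : ℕ} (m : ℕ) {x : (Fin n → Fin n) × (Fin n → Bool)}
    (hx : Function.Injective x.1) :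
    (Finset.univ.filter fun f : Fin n → Fin (m + 1) => IsCompatible x f).card =
      (m + (n - ∑ i, descFun x i)).choose n := by
  rw [← GapFun.card (descFun x) (fun i => by unfold descFun; split_ifs <;> simp) m,
    ← Fintype.card_subtype, ← Nat.card_eq_fintype_card]
  refine Nat.card_congr (Equiv.ofBijective (fun f => ⟨Fin.cons 0 fun i => (f.1 i : ℕ), rfl, ?_,
    (isCompatible_iff_gap hx).1 f.2⟩) ⟨fun f g h => ?_, fun F => ?_⟩)
  · cases n with
    | zero => exact Nat.zero_le _
    | succ k =>
      rw [← Fin.succ_last, Fin.cons_succ]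
      exact Nat.le_of_lt_succ (f.1 _).2
  · refine Subtype.ext (funext fun i => Fin.ext ?_)
    exact congrFun (congrArg GapFun.val h) i.succ
  · have hF : Monotone F.val := Fin.monotone_iff_le_succ.2 fun i => by
      have := F.gap i
      omega
    let f : Fin n → Fin (m + 1) := fun i =>
      ⟨F.val i.succ, Nat.lt_succ_of_le ((hF (Fin.le_last _)).trans F.val_last)⟩
    have hf : (Fin.cons 0 fun i => (f i : ℕ) : Fin (n + 1) → ℕ) = F.val := by
      funext i
      cases i using Fin.cases with
      | zero => exact F.val_zero.symm
      | succ j => rfl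
    refine ⟨⟨f, (isCompatible_iff_gap hx).2 ?_⟩, GapFun.ext hf⟩
    rw [hf]
    exact F.gap

/-- The signed permutation encoded by `x`. -/
noncomputable def signedPerm {n : ℕ} (x : (Fin n → Fin n) × (Fin n → Bool)) (a : ℤ) : ℤ :=
  if h : 1 ≤ a.natAbs ∧ a.natAbs ≤ n then
    a.sign * ((if x.2 ⟨a.natAbs - 1, by omega⟩ then 1 else -1) *
      ((x.1 ⟨a.natAbs - 1, by omega⟩ : ℕ) + 1))
  else a

theorem mem_OmegaSet {n : ℕ} {a : ℤ} : a ∈ OmegaSet n ↔ 1 ≤ a.natAbs ∧ a.natAbs ≤ n := by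
  simp only [OmegaSet, Set.mem_ofPred_eq, Int.abs_eq_natAbs]
  omega

theorem exists_fin_of_mem_OmegaSet {n : ℕ} {a : ℤ} (ha : a ∈ OmegaSet n) :
    ∃ i : Fin n, a = (i : ℕ) + 1 ∨ a = -((i : ℕ) + 1) := by
  rw [mem_OmegaSet] at ha
  refine ⟨⟨a.natAbs - 1, by omega⟩, ?_⟩
  dsimp only
  omega

theorem fin_mem_OmegaSet {n : ℕ} (i : Fin n) : ((i : ℕ) + 1 : ℤ) ∈ OmegaSet n := by
  rw [mem_OmegaSet]
  omega

theorem neg_mem_OmegaSet {n : ℕ} {a : ℤ} : -a ∈ OmegaSet n ↔ a ∈ OmegaSet n := by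
  simp [OmegaSet]

section

variable {n : ℕ} (x : (Fin n → Fin n) × (Fin n → Bool))

theorem signedPerm_of_notMem {a : ℤ} (ha : a ∉ OmegaSet n) : signedPerm x a = a := by
  rw [mem_OmegaSet] at ha
  exact dif_neg ha

theorem signedPerm_fin (i : Fin n) :
    signedPerm x ((i : ℕ) + 1) = (if x.2 i then 1 else -1) * ((x.1 i : ℕ) + 1) := by
  have h₁ : ((i : ℕ) + 1 : ℤ).natAbs - 1 = i := by omega
  have h₂ : ((i : ℕ) + 1 : ℤ).sign = 1 := Int.sign_eq_one_of_pos (by omega)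
  rw [signedPerm, dif_pos (mem_OmegaSet.1 (fin_mem_OmegaSet i))]
  simp only [h₁, h₂, one_mul, Fin.eta]

theorem signedPerm_neg (a : ℤ) : signedPerm x (-a) = -signedPerm x a := by
  unfold signedPerm
  by_cases h : 1 ≤ a.natAbs ∧ a.natAbs ≤ n
  · have h' : 1 ≤ (-a).natAbs ∧ (-a).natAbs ≤ n := by rwa [Int.natAbs_neg]
    rw [dif_pos h, dif_pos h', Int.sign_neg]
    simp only [Int.natAbs_neg, neg_mul]
  · have h' : ¬(1 ≤ (-a).natAbs ∧ (-a).natAbs ≤ n) := by rwa [Int.natAbs_neg]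
    rw [dif_neg h, dif_neg h']

end

theorem isSignedInvolution_of_involutive {n : ℕ} {w : ℤ → ℤ} (hneg : ∀ a, w (-a) = -w a)
    (hmem : ∀ i : Fin n, w ((i : ℕ) + 1) ∈ OmegaSet n) (hfix : ∀ a ∉ OmegaSet n, w a = a)
    (hinv : ∀ i : Fin n, w (w ((i : ℕ) + 1)) = (i : ℕ) + 1) : IsSignedInvolution n w := by
  have hmaps : Set.MapsTo w (OmegaSet n) (OmegaSet n) := by
    intro a ha
    obtain ⟨i, rfl | rfl⟩ := exists_fin_of_mem_OmegaSet ha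
    · exact hmem i
    · rw [hneg, neg_mem_OmegaSet]
      exact hmem i
  have hw (a : ℤ) : w (w a) = a := by
    by_cases ha : a ∈ OmegaSet n
    · obtain ⟨i, rfl | rfl⟩ := exists_fin_of_mem_OmegaSet ha
      · exact hinv i
      · rw [hneg, hneg, hinv]
    · rw [hfix a ha, hfix a ha]
  exact ⟨⟨hneg, Set.InvOn.bijOn ⟨fun a _ => hw a, fun a _ => hw a⟩ hmaps hmaps, hfix⟩, hw⟩

theorem isSignedInvolution_signedPerm {n : ℕ} {x : (Fin n → Fin n) × (Fin n → Bool)}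
    (hx : x ∈ signedPairs n) : IsSignedInvolution n (signedPerm x) := by
  rw [mem_signedPairs] at hx
  refine isSignedInvolution_of_involutive (signedPerm_neg x) (fun i => ?_)
    (fun a => signedPerm_of_notMem x) fun i => ?_
  · rw [signedPerm_fin]
    have := fin_mem_OmegaSet (x.1 i)
    split_ifs
    · rwa [one_mul]
    · rwa [neg_one_mul, neg_mem_OmegaSet]
  · rw [signedPerm_fin]
    by_cases h : x.2 i = true
    · rw [if_pos h, one_mul, signedPerm_fin, hx.2, if_pos h, one_mul, hx.1]
    · rw [if_neg h, neg_one_mul, signedPerm_neg, signedPerm_fin, hx.2, if_neg h, neg_one_mul,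
        neg_neg, hx.1]

theorem signedPerm_injective {n : ℕ} :
    Function.Injective (signedPerm : (Fin n → Fin n) × (Fin n → Bool) → ℤ → ℤ) := by
  intro x y h
  have key (i : Fin n) : x.1 i = y.1 i ∧ x.2 i = y.2 i := by
    have := congrFun h ((i : ℕ) + 1)
    rw [signedPerm_fin, signedPerm_fin] at this
    rw [Fin.ext_iff]
    revert this
    cases x.2 i <;> cases y.2 i <;> simp only [Bool.false_eq_true, ↓reduceIte, and_true,
      and_false, reduceCtorEq] <;> omega
  exact Prod.ext (funext fun i => (key i).1) (funext fun i => (key i).2)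

theorem exists_signedPerm_eq {n : ℕ} {w : ℤ → ℤ} (hw : IsSignedInvolution n w) :
    ∃ x ∈ signedPairs n, signedPerm x = w := by
  obtain ⟨⟨hneg, hbij, hfix⟩, hinv⟩ := hw
  have hmem (i : Fin n) : 1 ≤ (w ((i : ℕ) + 1)).natAbs ∧ (w ((i : ℕ) + 1)).natAbs ≤ n :=
    mem_OmegaSet.1 (hbij.mapsTo (fin_mem_OmegaSet i))
  let x : (Fin n → Fin n) × (Fin n → Bool) :=
    (fun i => ⟨(w ((i : ℕ) + 1)).natAbs - 1, by have := hmem i; omega⟩,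
      fun i => decide (0 < w ((i : ℕ) + 1)))
  have hx (i : Fin n) : w ((i : ℕ) + 1) = (if x.2 i then 1 else -1) * ((x.1 i : ℕ) + 1) := by
    have := hmem i
    simp only [x, decide_eq_true_eq]
    split_ifs <;> omega
  have heq : signedPerm x = w := by
    funext a
    by_cases ha : a ∈ OmegaSet n
    · obtain ⟨i, rfl | rfl⟩ := exists_fin_of_mem_OmegaSet ha
      · rw [signedPerm_fin, hx]
      · rw [signedPerm_neg, signedPerm_fin, hneg, hx]
    · rw [signedPerm_of_notMem x ha, hfix a ha]
  refine ⟨x, mem_signedPairs.2 ?_, heq⟩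
  have key (i : Fin n) : x.1 (x.1 i) = i ∧ x.2 (x.1 i) = x.2 i := by
    have h := hinv ((i : ℕ) + 1)
    rw [hx] at h
    rw [Fin.ext_iff]
    cases hs : x.2 i
    · simp only [hs, Bool.false_eq_true, if_false, neg_one_mul, hneg, hx (x.1 i)] at h
      cases hs' : x.2 (x.1 i) <;> simp [hs'] at h ⊢ <;> omega
    · simp only [hs, if_true, one_mul, hx (x.1 i)] at h
      cases hs' : x.2 (x.1 i) <;> simp [hs'] at h ⊢ <;> omega
  exact ⟨fun i => (key i).1, fun i => (key i).2⟩

theorem rlt_iff_lex {a b : ℤ} :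
    rlt a b ↔ toLex (decide (0 ≤ a), a.natAbs) < toLex (decide (0 ≤ b), b.natAbs) := by
  rw [Prod.Lex.toLex_lt_toLex, rlt]
  by_cases ha : 0 ≤ a <;> by_cases hb : 0 ≤ b <;>
    simp only [ha, hb, decide_true, decide_false, Bool.lt_iff, reduceCtorEq, true_and, false_and,
      and_true, and_false, and_self, false_or, or_false, iff_true,
      iff_false] <;> omega

theorem keyFun_eq {n : ℕ} (x : (Fin n → Fin n) × (Fin n → Bool)) (j : Fin (n + 1)) :
    keyFun x j = toLex (decide (0 ≤ signedPerm x (j : ℕ)), (signedPerm x (j : ℕ)).natAbs) := by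
  cases j using Fin.cases with
  | zero =>
    have : signedPerm x 0 = 0 := signedPerm_of_notMem x (by simp [mem_OmegaSet])
    simp [keyFun, this]
  | succ i =>
    rw [Fin.val_succ, Nat.cast_succ, signedPerm_fin, keyFun, Fin.cons_succ]
    cases h : x.2 i <;> simp <;> omega

theorem desB_signedPerm {n : ℕ} (x : (Fin n → Fin n) × (Fin n → Bool)) :
    desB n (signedPerm x) = ∑ i, descFun x i := by
  simp only [desB, descFun, Finset.card_filter, Finset.sum_range, rlt_iff_lex, keyFun_eq,
    Fin.val_succ, Fin.val_castSucc, Nat.cast_succ]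

theorem InkB_eq_card (n k : ℕ) :
    InkB n k = ((signedPairs n).filter fun x => ∑ i, descFun x i = k).card := by
  rw [InkB, ← Finset.card_image_of_injective _ signedPerm_injective, ← Set.ncard_coe_finset]
  congr 1
  ext w
  simp only [Set.mem_ofPred_eq, Finset.coe_image, Finset.coe_filter, Set.mem_image]
  constructor
  · rintro ⟨hw, hk⟩
    obtain ⟨x, hx, rfl⟩ := exists_signedPerm_eq hw
    exact ⟨x, ⟨hx, (desB_signedPerm x).symm.trans hk⟩, rfl⟩
  · rintro ⟨x, ⟨hx, hk⟩, rfl⟩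
    exact ⟨isSignedInvolution_signedPerm hx, (desB_signedPerm x).trans hk⟩

section

open PowerSeries

/-- The generating function of the signed involutions of length `n` by descents. -/
noncomputable def descentSeries (n : ℕ) : ℤ⟦X⟧ := mk fun k => (InkB n k : ℤ)

/-- The generating function over `m` of the numbers of swap-invariant multisets of `n` letters with
entries at most `m`. -/
noncomputable def letterSeries (n : ℕ) : ℤ⟦X⟧ :=
  mk fun m => ((symFun (Letter.swap (m := m)) n).card : ℤ)

theorem sum_descFun_le {n : ℕ} (x : (Fin n → Fin n) × (Fin n → Bool)) :
    ∑ i, descFun x i ≤ n := by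
  refine (Finset.sum_le_card_nsmul _ _ 1 fun i _ => ?_).trans (by simp)
  unfold descFun
  split_ifs <;> simp

theorem card_symFun_letter (n m : ℕ) : (symFun (Letter.swap (m := m)) n).card =
    ∑ x ∈ signedPairs n, (m + (n - ∑ i, descFun x i)).choose n := by
  rw [← card_standardPairs Letter.swap_involutive, ← sum_card_compatible]
  exact Finset.sum_congr rfl fun x hx => card_isCompatible m (mem_signedPairs.1 hx).1.injective

theorem letterSeries_eq_mul (n : ℕ) :
    letterSeries n = descentSeries n * mk fun j => ((n + j).choose n : ℤ) := by
  ext m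
  rw [coeff_mul, Finset.Nat.sum_antidiagonal_eq_sum_range_succ fun k j =>
    coeff k (descentSeries n) * coeff j (mk fun j => ((n + j).choose n : ℤ))]
  simp only [letterSeries, descentSeries, coeff_mk, card_symFun_letter, InkB_eq_card,
    Finset.card_filter]
  push_cast
  simp only [Finset.sum_mul, ite_mul, one_mul, zero_mul]
  rw [Finset.sum_comm]
  refine Finset.sum_congr rfl fun x _ => ?_
  rw [Finset.sum_ite_eq]
  have hd := sum_descFun_le x
  split_ifs with h
  · rw [Finset.mem_range] at h
    congr 2
    omega
  · rw [Finset.mem_range] at h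
    rw [Nat.choose_eq_zero_of_lt (by omega), Nat.cast_zero]

theorem letterSeries_mul_one_sub_pow (n : ℕ) :
    letterSeries n * (1 - X) ^ (n + 1) = descentSeries n := by
  rw [letterSeries_eq_mul, mul_assoc, mk_add_choose_mul_one_sub_pow_eq_one, mul_one]

/-- The Euler operator `X d/dX` on power series. -/
noncomputable def eulerOp (f : ℤ⟦X⟧) : ℤ⟦X⟧ := X * d⁄dX ℤ f

theorem coeff_eulerOp (f : ℤ⟦X⟧) (k : ℕ) : coeff k (eulerOp f) = k * coeff k f := by
  cases k with
  | zero => simp [eulerOp]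
  | succ k =>
    rw [eulerOp, coeff_succ_X_mul, coeff_derivative]
    push_cast
    ring

theorem coeff_natCast_mul (r : ℕ) (f : ℤ⟦X⟧) (k : ℕ) :
    coeff k ((r : ℤ⟦X⟧) * f) = r * coeff k f := by
  rw [← map_natCast (C (R := ℤ)), coeff_C_mul]

theorem coeff_ofNat_mul (r : ℕ) [r.AtLeastTwo] (f : ℤ⟦X⟧) (k : ℕ) :
    coeff k ((ofNat(r) : ℤ⟦X⟧) * f) = ofNat(r) * coeff k f :=
  coeff_natCast_mul r f k

theorem letterSeries_recurrence (n : ℕ) :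
    ((n : ℤ⟦X⟧) + 2) * letterSeries (n + 2) =
      2 * eulerOp (letterSeries (n + 1)) + letterSeries (n + 1) +
        (2 * eulerOp (eulerOp (letterSeries n)) + 2 * eulerOp (letterSeries n) +
          letterSeries n + n * letterSeries n) := by
  ext m
  simp only [add_mul, map_add, coeff_eulerOp, coeff_natCast_mul, coeff_ofNat_mul]
  have h : (n + 2) * (symFun (Letter.swap (m := m)) (n + 2)).card =
      (2 * m + 1) * (symFun (Letter.swap (m := m)) (n + 1)).card +
        (2 * m * (m + 1) + 1 + n) * (symFun (Letter.swap (m := m)) n).card := by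
    rw [← Letter.card_fixed, ← Letter.card_eq]
    convert card_symFun_recurrence Letter.swap_involutive n
  have h' := congrArg (Nat.cast : ℕ → ℤ) h
  push_cast at h'
  simp only [letterSeries, coeff_mk]
  linear_combination h'

theorem eulerOp_mul (f g : ℤ⟦X⟧) : eulerOp (f * g) = f * eulerOp g + g * eulerOp f := by
  simp only [eulerOp, Derivation.leibniz, smul_eq_mul]
  ring

theorem eulerOp_add (f g : ℤ⟦X⟧) : eulerOp (f + g) = eulerOp f + eulerOp g := by
  rw [eulerOp, map_add, mul_add, eulerOp, eulerOp]

theorem eulerOp_X : eulerOp X = X := by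
  rw [eulerOp, derivative_X, mul_one]

theorem eulerOp_sub (f g : ℤ⟦X⟧) : eulerOp (f - g) = eulerOp f - eulerOp g := by
  rw [eulerOp, map_sub, mul_sub, eulerOp, eulerOp]

theorem eulerOp_natCast (r : ℕ) : eulerOp r = 0 := by
  rw [eulerOp, Derivation.map_natCast, mul_zero]

theorem eulerOp_one : eulerOp 1 = 0 := by
  rw [eulerOp, Derivation.map_one_eq_zero, mul_zero]

theorem eulerOp_mul_one_sub_X_pow (f : ℤ⟦X⟧) (n : ℕ) :
    eulerOp (f * (1 - X) ^ (n + 1)) =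
      eulerOp f * (1 - X) ^ (n + 1) - ((n : ℤ⟦X⟧) + 1) * (X * f * (1 - X) ^ n) := by
  simp only [eulerOp, Derivation.leibniz, derivative_pow, map_sub, derivative_X,
    Derivation.map_one_eq_zero, add_tsub_cancel_right, smul_eq_mul]
  push_cast
  ring

theorem descentSeries_recurrence (n : ℕ) :
    ((n : ℤ⟦X⟧) + 2) * descentSeries (n + 2) =
      2 * eulerOp (descentSeries (n + 1)) + descentSeries (n + 1) +
      ((2 * (n : ℤ⟦X⟧) + 5) * (X * descentSeries (n + 1)) -
        2 * eulerOp (X * descentSeries (n + 1))) +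
      (((n : ℤ⟦X⟧) + 1) * descentSeries n + 2 * eulerOp (eulerOp (descentSeries n)) +
        2 * eulerOp (descentSeries n)) +
      (4 * ((n : ℤ⟦X⟧) + 2) * eulerOp (X * descentSeries n) -
        2 * ((n : ℤ⟦X⟧) + 1) * (X * descentSeries n) -
        4 * eulerOp (eulerOp (X * descentSeries n))) +
      ((2 * (n : ℤ⟦X⟧) + 1) * ((n : ℤ⟦X⟧) + 1) * (X ^ 2 * descentSeries n) +
        2 * eulerOp (eulerOp (X ^ 2 * descentSeries n)) -
        2 * (2 * (n : ℤ⟦X⟧) + 5) * eulerOp (X ^ 2 * descentSeries n) +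
        4 * (2 * (n : ℤ⟦X⟧) + 3) * (X ^ 2 * descentSeries n)) := by
  have hrec := letterSeries_recurrence n
  have hI₁ := eulerOp_mul_one_sub_X_pow (letterSeries (n + 1)) (n + 1)
  have hI₀ := eulerOp_mul_one_sub_X_pow (letterSeries n) n
  have hW : (1 - X) * eulerOp ((1 - X : ℤ⟦X⟧) ^ n) = -(n : ℤ⟦X⟧) * X * (1 - X) ^ n := by
    have h := eulerOp_mul_one_sub_X_pow 1 n
    rw [one_mul, pow_succ, eulerOp_mul, eulerOp_sub, eulerOp_one, eulerOp_X] at h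
    linear_combination h
  have hII₀ := congrArg eulerOp hI₀
  rw [eulerOp_sub, eulerOp_mul_one_sub_X_pow (eulerOp _), eulerOp_mul (_ + 1), eulerOp_add,
    eulerOp_natCast, eulerOp_one, eulerOp_mul (X * _), eulerOp_mul X, eulerOp_X] at hII₀
  simp only [pow_two, eulerOp_mul, eulerOp_X, eulerOp_add, mul_assoc]
  simp only [← letterSeries_mul_one_sub_pow, hII₀]
  rw [hI₀, hI₁]
  push_cast
  simp only [pow_succ]
  linear_combination ((1 - X) ^ n * (1 - X) ^ 3) * hrec +
    2 * X * (1 - X) * ((n : ℤ⟦X⟧) + 1) * letterSeries n * hW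

theorem IZ_natCast (n k : ℕ) : IZ n k = coeff k (descentSeries n) := by
  simp [IZ, descentSeries]

theorem IZ_sub_natCast (n k j : ℕ) : IZ n (k - j) = coeff k (X ^ j * descentSeries n) := by
  rw [coeff_X_pow_mul', IZ]
  split_ifs with h₁ h₂ h₂
  · simp only [descentSeries, coeff_mk]
    congr 3
    omega
  · omega
  · omega
  · rfl

end

/-- Proposition 3.2: the linear recurrence for the numbers `I_{n,k}^B` (with the convention
`I_{n,k}^B = 0` for `k < 0`), valid for all `n ≥ 3` and `k ≥ 0`. -/
theorem InkB_recurrence (n : ℕ) (hn : 3 ≤ n) (k : ℤ) (hk : 0 ≤ k) :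
    (n : ℤ) * IZ n k =
      (2 * k + 1) * IZ (n - 1) k + (2 * (n : ℤ) - 2 * k + 1) * IZ (n - 1) (k - 1) +
        ((n : ℤ) - 1 + 2 * k * (k + 1)) * IZ (n - 2) k +
        (2 * ((n : ℤ) - 1) + 4 * ((n : ℤ) - k - 1) * (k - 1)) * IZ (n - 2) (k - 1) +
        ((2 * (n : ℤ) - 3) * ((n : ℤ) - 1) + 2 * (k - 2) * (k - 2 * (n : ℤ) + 1)) *
          IZ (n - 2) (k - 2) := by
  obtain ⟨n, rfl⟩ : ∃ N, n = N + 2 := ⟨n - 2, by omega⟩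
  lift k to ℕ using hk
  have h₁ := IZ_sub_natCast n k 1
  have h₂ := IZ_sub_natCast n k 2
  have h₃ := IZ_sub_natCast (n + 1) k 1
  have h := congrArg (PowerSeries.coeff k) (descentSeries_recurrence n)
  rw [pow_one, Nat.cast_one] at h₁ h₃
  rw [Nat.cast_two] at h₂
  simp only [add_mul, mul_add, mul_assoc, map_add, map_sub, coeff_eulerOp, coeff_natCast_mul,
    coeff_ofNat_mul, one_mul, ← IZ_natCast, ← h₁, ← h₂, ← h₃] at h
  rw [show n + 2 - 1 = n + 1 by omega, show n + 2 - 2 = n by omega]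
  push_cast
  linear_combination h
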